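/- Let (N,M₀) be a safe Petri net and U its unfolding with folding map f. For every finite configuration C of U, there is a linearization of C into a firing sequence of U from c₀, and Mark(C)=f(cut(C)) is a marking of N reachable from M₀. -/

import Mathlib

/-- A net `N = (P,T,F)`: the flow relation is split into its
place-to-transition part `pt` and transition-to-place part `tp`. -/
structure Net (P T : Type) where
  pt : P → T → Prop
  tp : T → P → Prop

namespace Net

variable {P T : Type} (N : Net P T)

/-- Preset of a transition: `•t`. -/
def preT (t : T) : Set P := {p | N.pt p t}
/-- Postset of a transition: `t•`. -/
def postT (t : T) : Set P := {p | N.tp t p}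
/-- Preset of a place: `•p`. -/
def preP (p : P) : Set T := {t | N.tp t p}
/-- Postset of a place: `p•`. -/
def postP (p : P) : Set T := {t | N.pt p t}

/-- Transition `t` is enabled at marking `M` iff `•t ⊆ M`. -/
def enabled (M : Set P) (t : T) : Prop := N.preT t ⊆ M
/-- Firing `t` at `M` yields `(M \ •t) ∪ t•`. -/
def fire (M : Set P) (t : T) : Set P := (M \ N.preT t) ∪ N.postT t
/-- One firing step between markings. -/
def stepRel (M M' : Set P) : Prop := ∃ t : T, N.enabled M t ∧ M' = N.fire M t
/-- Reachability between markings (finite firing sequences). -/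
def reach (M M' : Set P) : Prop := Relation.ReflTransGen N.stepRel M M'

/-- `(N, M₀)` is safe. -/
def safe (M₀ : Set P) : Prop :=
  ∀ M : Set P, N.reach M₀ M → ∀ t : T, N.enabled M t → M ∩ N.postT t ⊆ N.preT t

/-- `FiringSeq M l M'`: the sequence `l` of transitions can fire from `M`, ending in `M'`. -/
inductive FiringSeq : Set P → List T → Set P → Prop
  | nil (M : Set P) : FiringSeq M [] M
  | cons {M : Set P} (t : T) {l : List T} {M' : Set P} :
      N.enabled M t → FiringSeq (N.fire M t) l M' → FiringSeq M (t :: l) M'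

/-- The underlying edge relation of the flow, on nodes `P ⊕ T`. -/
def edge : (P ⊕ T) → (P ⊕ T) → Prop
  | Sum.inl p, Sum.inr t => N.pt p t
  | Sum.inr t, Sum.inl p => N.tp t p
  | _, _ => False

/-- Causality: `x < y` via a nonempty directed path. -/
def ltN (x y : P ⊕ T) : Prop := Relation.TransGen N.edge x y
/-- `x ≤ y` iff `x < y` or `x = y`. -/
def leN (x y : P ⊕ T) : Prop := N.ltN x y ∨ x = y

/-- Direct conflict of transitions: `•u ∩ •v ≠ ∅`. -/
def dirConflict (u v : T) : Prop := (N.preT u ∩ N.preT v).Nonempty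
/-- Conflict of nodes `x # y`. -/
def conflict (x y : P ⊕ T) : Prop :=
  ∃ u v : T, u ≠ v ∧ N.leN (Sum.inr u) x ∧ N.leN (Sum.inr v) y ∧ N.dirConflict u v
/-- Concurrency of nodes. -/
def concurrent (x y : P ⊕ T) : Prop :=
  ¬ N.leN x y ∧ ¬ N.leN y x ∧ ¬ N.conflict x y
/-- A co-set: a set of pairwise concurrent places (conditions). -/
def coset (S : Set P) : Prop :=
  ∀ b ∈ S, ∀ b' ∈ S, b ≠ b' → N.concurrent (Sum.inl b) (Sum.inl b')

end Net

/-- An occurrence net `O = (B, E, F, c₀)`: conditions `B`, events `E`. -/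
structure OccNet (B E : Type) extends Net B E where
  c₀ : Set B
  lt_irrefl : ∀ x : B ⊕ E, ¬ toNet.ltN x x
  pre_subsingleton : ∀ b : B, (toNet.preP b).Subsingleton
  mem_c₀_iff : ∀ b : B, b ∈ c₀ ↔ toNet.preP b = ∅
  no_self_conflict : ∀ e : E, ¬ toNet.conflict (Sum.inr e) (Sum.inr e)
  finite_past : ∀ e : E, {x : B ⊕ E | toNet.leN x (Sum.inr e)}.Finite

namespace OccNet

variable {B E : Type} (O : OccNet B E)

/-- A configuration: a causally closed, conflict-free set of events. -/
def config (C : Set E) : Prop :=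
  (∀ e ∈ C, ∀ e' : E, O.toNet.ltN (Sum.inr e') (Sum.inr e) → e' ∈ C) ∧
  (∀ e ∈ C, ∀ e' ∈ C, ¬ O.toNet.conflict (Sum.inr e) (Sum.inr e'))

/-- A run: a `⊆`-maximal configuration. -/
def run (ω : Set E) : Prop :=
  O.config ω ∧ ∀ C : Set E, O.config C → ω ⊆ C → C = ω

/-- `cut C = (c₀ ∪ C•) \ •C`. -/
def cut (C : Set E) : Set B :=
  (O.c₀ ∪ {b | ∃ e ∈ C, O.toNet.tp e b}) \ {b | ∃ e ∈ C, O.toNet.pt b e}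

/-- Event `e` is enabled by configuration `C`. -/
def enabledBy (C : Set E) (e : E) : Prop := e ∉ C ∧ O.config (C ∪ {e})

/-- `crest C`: the `<`-maximal events of `C`. -/
def crest (C : Set E) : Set E :=
  {e | e ∈ C ∧ ¬ ∃ e' ∈ C, O.toNet.ltN (Sum.inr e) (Sum.inr e')}

/-- The stump `⌊e⌋ = {e' : e' < e}` of an event. -/
def stump (e : E) : Set E := {e' | O.toNet.ltN (Sum.inr e') (Sum.inr e)}

/-- `spoiler e e'`: `e'` is a spoiler of `e`, i.e. `•e' ∩ •e ≠ ∅`. -/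
def spoiler (e e' : E) : Prop := (O.toNet.preT e' ∩ O.toNet.preT e).Nonempty

/-- An event is unchallenged iff no other event shares a precondition with it. -/
def unchallenged (e : E) : Prop :=
  ¬ ∃ e' : E, e' ≠ e ∧ (O.toNet.preT e' ∩ O.toNet.preT e).Nonempty

/-- A configuration is shaved iff its crest contains no unchallenged event. -/
def shaved (C : Set E) : Prop := ∀ e ∈ O.crest C, ¬ O.unchallenged e

/-- Strict `C`-conflict `e #^C e'`: `e ≠ e'`, `•e ∩ •e' ≠ ∅`, and `⌊e'⌋ ⊆ C`. -/
def strictConflict (C : Set E) (e e' : E) : Prop :=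
  e ≠ e' ∧ (O.toNet.preT e ∩ O.toNet.preT e').Nonempty ∧ O.stump e' ⊆ C

/-- Decisional height `δ(C)`: the number of events of `C` in strict `C`-conflict
with some event. -/
noncomputable def dHeight (C : Set E) : ℕ :=
  {e | e ∈ C ∧ ∃ e' : E, O.strictConflict C e e'}.ncard

end OccNet

/-- The unfolding `U = U(N, M₀)` of a Petri net `(N, M₀)`: an occurrence net with
conditions `B` and events `E`, together with the folding map (`fB` on conditions,
`fE` on events), satisfying the defining properties of the inductive construction:
the initial cut corresponds bijectively to `M₀`; the preset of an event `e` is a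
co-set folded bijectively onto `•f(e)` and its postset is folded bijectively onto
`f(e)•`; events are uniquely determined by (preset, label) and exist for every
co-set folding onto some `•t`; conditions are uniquely determined by
(producing event, label). -/
structure Unfolding (P T : Type) (N : Net P T) (M₀ : Set P) (B E : Type) where
  occ : OccNet B E
  fB : B → P
  fE : E → T
  init_bij : Set.BijOn fB occ.c₀ M₀
  pre_coset : ∀ e : E, occ.toNet.coset (occ.toNet.preT e)
  pre_bij : ∀ e : E, Set.BijOn fB (occ.toNet.preT e) (N.preT (fE e))
  post_bij : ∀ e : E, Set.BijOn fB (occ.toNet.postT e) (N.postT (fE e))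
  event_unique : ∀ e e' : E,
    occ.toNet.preT e = occ.toNet.preT e' → fE e = fE e' → e = e'
  event_exists : ∀ (S : Set B) (t : T), occ.toNet.coset S → Set.BijOn fB S (N.preT t) →
    ∃ e : E, occ.toNet.preT e = S ∧ fE e = t
  cond_unique : ∀ b b' : B,
    occ.toNet.preP b = occ.toNet.preP b' → fB b = fB b' → b = b'

/-- `Bad` is reachability-closed: `M ∈ Bad` and `M → M'` imply `M' ∈ Bad`. -/
def ReachClosed {P T : Type} (N : Net P T) (Bad : Set (Set P)) : Prop :=
  ∀ M ∈ Bad, ∀ M' : Set P, N.reach M M' → M' ∈ Bad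

namespace Unfolding

variable {P T B E : Type} {N : Net P T} {M₀ : Set P} (U : Unfolding P T N M₀ B E)

/-- `Mark C = f(cut C)`. -/
def Mark (C : Set E) : Set P := U.fB '' U.occ.cut C

/-- A finite configuration is doomed iff every run extending it contains a finite
configuration (extending it) whose marking is bad. -/
def doomed (Bad : Set (Set P)) (C : Set E) : Prop :=
  ∀ ω : Set E, U.occ.run ω → C ⊆ ω →
    ∃ C' : Set E, C'.Finite ∧ U.occ.config C' ∧ C ⊆ C' ∧ C' ⊆ ω ∧ U.Mark C' ∈ Bad

/-- A configuration is free iff it is not doomed. -/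
def free (Bad : Set (Set P)) (C : Set E) : Prop := ¬ U.doomed Bad C

/-- A finite configuration is minimally doomed iff it is doomed and no proper
sub-configuration of it is doomed. -/
def minDoomed (Bad : Set (Set P)) (C : Set E) : Prop :=
  C.Finite ∧ U.occ.config C ∧ U.doomed Bad C ∧
  ∀ C' : Set E, C' ⊂ C → U.occ.config C' → ¬ U.doomed Bad C'

/-- A (finite) prefix of the unfolding: a finite, causally closed set of events. -/
def isPrefix (E' : Set E) : Prop :=
  E'.Finite ∧ ∀ e ∈ E', ∀ e' : E, U.occ.toNet.ltN (Sum.inr e') (Sum.inr e) → e' ∈ E'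

/-- A complete prefix `Π₀` of the unfolding. -/
def isCompletePrefix (E' : Set E) : Prop :=
  U.isPrefix E' ∧
  ∀ M : Set P, N.reach M₀ M →
    ∃ C : Set E, U.occ.config C ∧ C ⊆ E' ∧ U.Mark C = M ∧
      ∀ t : T, N.enabled M t → ∃ e ∈ E', U.fE e = t ∧ U.occ.enabledBy C e

/-- `isPi1 E₀ E₁`: `E₀` is a complete prefix `Π₀` and `E₁` is the prefix `Π₁`
obtained by appending, after every `⊆`-maximal configuration `Cm` of `Π₀`, a
complete prefix of the unfolding of `(N, Mark Cm)`. -/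
def isPi1 (E₀ E₁ : Set E) : Prop :=
  U.isCompletePrefix E₀ ∧ U.isPrefix E₁ ∧ E₀ ⊆ E₁ ∧
  ∀ Cm : Set E, U.occ.config Cm → Cm ⊆ E₀ →
    (∀ C' : Set E, U.occ.config C' → C' ⊆ E₀ → Cm ⊆ C' → C' = Cm) →
    ∀ M : Set P, N.reach (U.Mark Cm) M →
      ∃ C : Set E, U.occ.config C ∧ Cm ⊆ C ∧ C ⊆ E₁ ∧ U.Mark C = M ∧
        ∀ t : T, N.enabled M t → ∃ e ∈ E₁, U.fE e = t ∧ U.occ.enabledBy C e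

end Unfolding

namespace Net

variable {P T : Type} {N : Net P T}

theorem FiringSeq.snoc {M M' : Set P} {l : List T} (h : N.FiringSeq M l M') {t : T}
    (ht : N.enabled M' t) : N.FiringSeq M (l ++ [t]) (N.fire M' t) := by
  induction h with
  | nil M => exact .cons t ht (.nil _)
  | cons s hs _ ih => exact .cons s hs (ih ht)

theorem ltN_of_tp_of_pt {s t : T} {p : P} (hs : N.tp s p) (ht : N.pt p t) :
    N.ltN (Sum.inr s) (Sum.inr t) :=
  .tail (b := Sum.inl p) (.single hs) ht

end Net

namespace OccNet

variable {B E : Type} (O : OccNet B E)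

theorem ncard_past_lt {e e' : E} (h : O.toNet.ltN (Sum.inr e) (Sum.inr e')) :
    {x | O.toNet.leN x (Sum.inr e)}.ncard < {x | O.toNet.leN x (Sum.inr e')}.ncard := by
  apply Set.ncard_lt_ncard _ (O.finite_past e')
  refine ⟨?_, fun hsub => ?_⟩
  · rintro x (hx | rfl)
    · exact Or.inl (hx.trans h)
    · exact Or.inl h
  · rcases hsub (show Sum.inr e' ∈ {x | O.toNet.leN x (Sum.inr e')} from Or.inr rfl) with hx | hx
    · exact O.lt_irrefl _ (h.trans hx)
    · exact O.lt_irrefl _ (hx ▸ h)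

/-- A nonempty finite set of events has a causally maximal event. -/
theorem crest_nonempty {C : Set E} (hfin : C.Finite) (hne : C.Nonempty) :
    (O.crest C).Nonempty := by
  obtain ⟨e, he, hmax⟩ := Set.exists_max_image C
    (fun e => {x | O.toNet.leN x (Sum.inr e)}.ncard) hfin hne
  exact ⟨e, he, fun ⟨e', he', hlt⟩ => (O.ncard_past_lt hlt).not_ge (hmax e' he')⟩

variable {O} {C : Set E} {e : E}

theorem config.diff_crest (hC : O.config C) (he : e ∈ O.crest C) : O.config (C \ {e}) := by
  refine ⟨fun a ha a' hlt => ⟨hC.1 a ha.1 a' hlt, ?_⟩, fun a ha a' ha' => hC.2 a ha.1 a' ha'.1⟩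
  rintro rfl
  exact he.2 ⟨a, ha.1, hlt⟩

theorem config.enabled_cut_diff_crest (hC : O.config C) (he : e ∈ O.crest C) :
    O.toNet.enabled (O.cut (C \ {e})) e := by
  intro b hb
  refine ⟨?_, ?_⟩
  · by_cases hb₀ : b ∈ O.c₀
    · exact Or.inl hb₀
    · rw [O.mem_c₀_iff, ← ne_eq, ← Set.nonempty_iff_ne_empty] at hb₀
      obtain ⟨a, ha⟩ := hb₀
      have hlt := Net.ltN_of_tp_of_pt ha hb
      refine Or.inr ⟨a, ⟨hC.1 e he.1 a hlt, ?_⟩, ha⟩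
      rintro rfl
      exact O.lt_irrefl _ hlt
  · rintro ⟨a, ha, hab⟩
    exact hC.2 a ha.1 e he.1 ⟨a, e, ha.2, Or.inr rfl, Or.inr rfl, b, hab, hb⟩

theorem cut_eq_fire_of_mem_crest (he : e ∈ O.crest C) :
    O.cut C = O.toNet.fire (O.cut (C \ {e})) e := by
  ext b
  constructor
  · rintro ⟨hprod, hcons⟩
    by_cases hb : O.toNet.tp e b
    · exact Or.inr hb
    · refine Or.inl ⟨⟨?_, fun ⟨a, ha, hab⟩ => hcons ⟨a, ha.1, hab⟩⟩,
        fun h => hcons ⟨e, he.1, h⟩⟩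
      rcases hprod with h | ⟨a, ha, hab⟩
      · exact Or.inl h
      · refine Or.inr ⟨a, ⟨ha, ?_⟩, hab⟩
        rintro rfl
        exact hb hab
  · rintro (⟨⟨hprod, hcons⟩, hb⟩ | hb)
    · refine ⟨hprod.imp_right fun ⟨a, ha, hab⟩ => ⟨a, ha.1, hab⟩, ?_⟩
      rintro ⟨a, ha, hab⟩
      refine hcons ⟨a, ⟨ha, ?_⟩, hab⟩
      rintro rfl
      exact hb hab
    · exact ⟨Or.inr ⟨e, he.1, hb⟩,
        fun ⟨a, ha, hab⟩ => he.2 ⟨a, ha, Net.ltN_of_tp_of_pt hb hab⟩⟩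

theorem cut_empty : O.cut ∅ = O.c₀ := by
  simp [cut]

/-- Every finite configuration is the result of adding events one by one to the empty one. -/
theorem config.induction_crest {motive : Set E → Prop} (empty : motive ∅)
    (step : ∀ C e, O.config C → e ∈ O.crest C → motive (C \ {e}) → motive C)
    (hfin : C.Finite) (hC : O.config C) : motive C := by
  induction hn : C.ncard generalizing C with
  | zero => rwa [(Set.ncard_eq_zero hfin).1 hn]
  | succ n ih =>
    obtain ⟨e, he⟩ := O.crest_nonempty hfin (Set.nonempty_of_ncard_ne_zero (by omega))
    refine step C e hC he (ih hfin.sdiff (hC.diff_crest he) ?_)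
    rw [Set.ncard_sdiff_singleton_of_mem he.1, hn, Nat.add_sub_cancel]

theorem config.exists_firingSeq (hfin : C.Finite) (hC : O.config C) :
    ∃ l : List E, l.Nodup ∧ {e : E | e ∈ l} = C ∧ O.toNet.FiringSeq O.c₀ l (O.cut C) := by
  refine config.induction_crest (motive := fun C => ∃ l : List E, l.Nodup ∧ {e : E | e ∈ l} = C ∧
    O.toNet.FiringSeq O.c₀ l (O.cut C)) ⟨[], .nil, by simp, ?_⟩ ?_ hfin hC
  · rw [cut_empty]
    exact .nil _
  · rintro C e hC he ⟨l, hnd, hl, hseq⟩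
    have hmem : ∀ a, a ∈ l ↔ a ∈ C ∧ a ≠ e := fun a => Set.ext_iff.1 hl a
    refine ⟨l ++ [e], ?_, ?_, ?_⟩
    · simp only [List.nodup_append, hnd, List.nodup_singleton, true_and]
      intro a ha b hb
      rw [List.mem_singleton.1 hb]
      exact ((hmem a).1 ha).2
    · ext a
      by_cases hae : a = e
      · simp [hae, he.1]
      · simp [hmem, hae]
    · rw [cut_eq_fire_of_mem_crest he]
      exact hseq.snoc (hC.enabled_cut_diff_crest he)

end OccNet

namespace Unfolding

variable {P T B E : Type} {N : Net P T} {M₀ : Set P} (U : Unfolding P T N M₀ B E)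
  {K : Set B} {e : E}

theorem enabled_image (he : U.occ.toNet.enabled K e) : N.enabled (U.fB '' K) (U.fE e) := by
  rw [Net.enabled, ← (U.pre_bij e).image_eq]
  exact Set.image_mono he

theorem image_fire (hK : Set.InjOn U.fB K) (he : U.occ.toNet.enabled K e) :
    U.fB '' U.occ.toNet.fire K e = N.fire (U.fB '' K) (U.fE e) := by
  rw [Net.fire, Net.fire, Set.image_union, (U.post_bij e).image_eq,
    hK.image_sdiff_subset he, (U.pre_bij e).image_eq]

theorem injOn_fire (hK : Set.InjOn U.fB K) (he : U.occ.toNet.enabled K e)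
    (hsafe : U.fB '' K ∩ N.postT (U.fE e) ⊆ N.preT (U.fE e)) :
    Set.InjOn U.fB (U.occ.toNet.fire K e) := by
  have cross : ∀ b ∈ K \ U.occ.toNet.preT e, ∀ b' ∈ U.occ.toNet.postT e,
      U.fB b ≠ U.fB b' := by
    intro b hb b' hb' heq
    have hpre := hsafe ⟨Set.mem_image_of_mem _ hb.1, heq ▸ (U.post_bij e).mapsTo hb'⟩
    obtain ⟨c, hc, hcb⟩ := (U.pre_bij e).surjOn hpre
    exact hb.2 (hK (he hc) hb.1 hcb ▸ hc)
  rintro b (hb | hb) b' (hb' | hb') heq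
  · exact hK hb.1 hb'.1 heq
  · exact absurd heq (cross b hb b' hb')
  · exact absurd heq.symm (cross b' hb' b hb)
  · exact (U.post_bij e).injOn hb hb' heq

/-- In the unfolding of a safe net, the marking of a finite configuration is reachable, and the
folding map is injective on its cut. -/
theorem reach_mark_and_injOn_cut (hsafe : N.safe M₀) {C : Set E} (hfin : C.Finite)
    (hC : U.occ.config C) : N.reach M₀ (U.Mark C) ∧ Set.InjOn U.fB (U.occ.cut C) := by
  refine OccNet.config.induction_crest
    (motive := fun C => N.reach M₀ (U.Mark C) ∧ Set.InjOn U.fB (U.occ.cut C)) ?_ ?_ hfin hC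
  · rw [Mark, OccNet.cut_empty, U.init_bij.image_eq]
    exact ⟨.refl, U.init_bij.injOn⟩
  · rintro C e hC he ⟨hreach, hinj⟩
    have hen := hC.enabled_cut_diff_crest he
    have hen' := U.enabled_image hen
    rw [Mark, OccNet.cut_eq_fire_of_mem_crest he]
    exact ⟨hreach.tail ⟨U.fE e, hen', U.image_fire hinj hen⟩,
      U.injOn_fire hinj hen (hsafe _ hreach _ hen')⟩

end Unfolding

/-- part of Lemma 1 of the paper: every finite configuration `C`
of the unfolding of a safe Petri net can be linearized into a firing sequence
of the unfolding from the initial cut `c₀` (leading to `cut C`), and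
`Mark C = f(cut C)` is a marking of `N` reachable from `M₀`. -/
theorem config_linearization_and_mark_reachable
    {P T B E : Type} [Finite P] [Finite T]
    (N : Net P T) (M₀ : Set P) (hsafe : N.safe M₀)
    (U : Unfolding P T N M₀ B E)
    (C : Set E) (hfin : C.Finite) (hC : U.occ.config C) :
    (∃ l : List E, l.Nodup ∧ {e : E | e ∈ l} = C ∧
      U.occ.toNet.FiringSeq U.occ.c₀ l (U.occ.cut C)) ∧
    N.reach M₀ (U.Mark C) := by
  exact ⟨hC.exists_firingSeq hfin, (U.reach_mark_and_injOn_cut hsafe hfin hC).1⟩
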